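/- Let F be a field and let Ω be a connected, eventually outward, finitely branching tree quiver. If f : U → W is a morphism of indecomposable FLEI representations of Ω which is nonzero, not an isomorphism, not surjective, and not injective, then there exist an indecomposable FLEI representation V, a surjective morphism g : U → V which is nonzero and not an isomorphism, and an injective morphism h : V → W which is nonzero and not an isomorphism. -/

import Mathlib

/-- A quiver: a set of vertices, a set of arrows, with source and target maps. -/
structure Quiv : Type 1 where
  V : Type
  A : Type
  s : A → V
  t : A → V

/-- A representation of a quiver over a field `F`. -/
structure QRep (F : Type) [Field F] (Q : Quiv) : Type 1 where
  M : Q.V → Type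
  [acg : ∀ i, AddCommGroup (M i)]
  [mod : ∀ i, Module F (M i)]
  map : ∀ a : Q.A, M (Q.s a) →ₗ[F] M (Q.t a)

attribute [instance] QRep.acg QRep.mod

namespace QRep

variable {F : Type} [Field F] {Q : Quiv}

/-- A representation is nonzero if some vertex space has a nonzero vector. -/
def Nonzero (V : QRep F Q) : Prop := ∃ i, ∃ x : V.M i, x ≠ 0

/-- A morphism of representations. -/
structure Hom (V W : QRep F Q) : Type where
  app : ∀ i, V.M i →ₗ[F] W.M i
  comm : ∀ a : Q.A, (W.map a).comp (app (Q.s a)) = (app (Q.t a)).comp (V.map a)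

/-- A morphism is an isomorphism iff it is bijective at each vertex. -/
def Hom.IsIso {V W : QRep F Q} (f : Hom V W) : Prop := ∀ i, Function.Bijective (f.app i)

/-- Two representations are isomorphic. -/
def Iso (V W : QRep F Q) : Prop := ∃ f : Hom V W, f.IsIso

/-- The (external) direct sum of two representations. -/
def dsum (V W : QRep F Q) : QRep F Q where
  M i := V.M i × W.M i
  map a := (V.map a).prodMap (W.map a)

/-- A representation is indecomposable if it is nonzero and not isomorphic to a direct
sum of two nonzero representations. -/
def Indec (V : QRep F Q) : Prop :=
  V.Nonzero ∧ ∀ A B : QRep F Q, A.Nonzero → B.Nonzero → ¬ Iso V (dsum A B)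

/-- FLEI: locally finite-dimensional, and all but finitely many arrow maps are
isomorphisms. -/
def IsFLEI (V : QRep F Q) : Prop :=
  (∀ i, FiniteDimensional F (V.M i)) ∧ {a : Q.A | ¬ Function.Bijective (V.map a)}.Finite

end QRep

/-- A subrepresentation: a subspace at each vertex, stable under the arrow maps. -/
structure Subrep {F : Type} [Field F] {Q : Quiv} (V : QRep F Q) : Type where
  S : ∀ i, Submodule F (V.M i)
  stable : ∀ a : Q.A, ∀ x ∈ S (Q.s a), V.map a x ∈ S (Q.t a)

namespace Subrep

variable {F : Type} [Field F] {Q : Quiv} {V : QRep F Q}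

/-- A subrepresentation, viewed as a representation in its own right. -/
def toRep (W : Subrep V) : QRep F Q where
  M i := ↥(W.S i)
  map a := (V.map a).restrict (W.stable a)

/-- The quotient of a representation by a subrepresentation. -/
def quot (W : Subrep V) : QRep F Q where
  M i := V.M i ⧸ W.S i
  map a := Submodule.mapQ _ _ (V.map a) (fun x hx => W.stable a x hx)

end Subrep
/-- Adjacency in the underlying graph of a quiver. -/
def Quiv.Adj (Q : Quiv) (i j : Q.V) : Prop :=
  ∃ a : Q.A, (Q.s a = i ∧ Q.t a = j) ∨ (Q.s a = j ∧ Q.t a = i)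

/-- The underlying graph is connected. -/
def Quiv.Connected (Q : Quiv) : Prop :=
  ∀ i j : Q.V, Relation.ReflTransGen Q.Adj i j

/-- Source of an oriented edge-traversal (arrow plus direction of traversal). -/
def Quiv.esrc (Q : Quiv) (p : Q.A × Bool) : Q.V := if p.2 then Q.s p.1 else Q.t p.1

/-- Target of an oriented edge-traversal. -/
def Quiv.etgt (Q : Quiv) (p : Q.A × Bool) : Q.V := if p.2 then Q.t p.1 else Q.s p.1

/-- `e 0, …, e (n-1)` is a cycle: a closed walk of positive length in the underlying
graph traversing no edge twice. -/
def Quiv.IsCycle (Q : Quiv) (n : ℕ) (e : ℕ → Q.A × Bool) : Prop :=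
  0 < n ∧ (∀ k < n, Q.etgt (e k) = Q.esrc (e ((k + 1) % n))) ∧
    (∀ j < n, ∀ k < n, (e j).1 = (e k).1 → j = k)

/-- The quiver has no cycles in its underlying graph. -/
def Quiv.NoCycles (Q : Quiv) : Prop := ¬ ∃ (n : ℕ) (e : ℕ → Q.A × Bool), Q.IsCycle n e

/-- A tree quiver: connected underlying graph with no cycles. -/
def Quiv.IsTree (Q : Quiv) : Prop := Q.Connected ∧ Q.NoCycles
/-- A journey in a quiver: a finite or infinite sequence of pairwise distinct vertices
`vert 0, vert 1, …` (up to index `len`, which may be `⊤`), consecutive vertices being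
joined by an arrow (in either direction). -/
structure Journey (Q : Quiv) : Type where
  len : ℕ∞
  vert : ℕ → Q.V
  edge : ∀ k : ℕ, (k : ℕ∞) < len → Q.A
  inj : ∀ m n : ℕ, (m : ℕ∞) ≤ len → (n : ℕ∞) ≤ len → vert m = vert n → m = n
  adj : ∀ (k : ℕ) (h : (k : ℕ∞) < len),
    (Q.s (edge k h) = vert k ∧ Q.t (edge k h) = vert (k + 1)) ∨
    (Q.s (edge k h) = vert (k + 1) ∧ Q.t (edge k h) = vert k)

/-- A quiver is eventually outward if every journey contains only finitely many arrows
pointing towards the start of the journey. -/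
def Quiv.EventuallyOutward (Q : Quiv) : Prop :=
  ∀ j : Journey Q,
    {k : ℕ | ∃ h : (k : ℕ∞) < j.len,
      Q.s (j.edge k h) = j.vert (k + 1) ∧ Q.t (j.edge k h) = j.vert k}.Finite

/-- A quiver is finitely branching if it is a union of finitely many journeys. -/
def Quiv.FinitelyBranching (Q : Quiv) : Prop :=
  ∃ (n : ℕ) (js : Fin n → Journey Q),
    (∀ v : Q.V, ∃ (m : Fin n) (k : ℕ), (k : ℕ∞) ≤ (js m).len ∧ (js m).vert k = v) ∧
    (∀ a : Q.A, ∃ (m : Fin n) (k : ℕ) (h : (k : ℕ∞) < (js m).len), (js m).edge k h = a)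
namespace QRep

variable {F : Type} [Field F] {Q : Quiv}

/-- A morphism is nonzero if it is nonzero at some vertex. -/
def Hom.Nonzero {V W : QRep F Q} (f : Hom V W) : Prop := ∃ i, f.app i ≠ 0

/-- A morphism is injective if it is injective at every vertex. -/
def Hom.Injective {V W : QRep F Q} (f : Hom V W) : Prop :=
  ∀ i, Function.Injective (f.app i)

/-- A morphism is surjective if it is surjective at every vertex. -/
def Hom.Surjective {V W : QRep F Q} (f : Hom V W) : Prop :=
  ∀ i, Function.Surjective (f.app i)

end QRep

namespace QRep

variable {F : Type} [Field F] {Q : Quiv}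

/-- Composition of morphisms of representations. -/
def Hom.comp {X Y Z : QRep F Q} (g : Hom Y Z) (f : Hom X Y) : Hom X Z where
  app i := (g.app i).comp (f.app i)
  comm a := by
    rw [← LinearMap.comp_assoc, g.comm, LinearMap.comp_assoc, f.comm, LinearMap.comp_assoc]

/-- The inverse of an isomorphism of representations. -/
noncomputable def Hom.inv {X Y : QRep F Q} (f : Hom X Y) (hf : f.IsIso) : Hom Y X where
  app i := (LinearEquiv.ofBijective (f.app i) (hf i)).symm
  comm a := by
    ext y
    obtain ⟨x, rfl⟩ := (hf (Q.s a)).2 y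
    apply (hf (Q.t a)).1
    have h₁ := (LinearEquiv.ofBijective (f.app (Q.s a)) (hf _)).symm_apply_apply x
    have h₂ := (LinearEquiv.ofBijective (f.app (Q.t a)) (hf _)).apply_symm_apply
      (Y.map a (f.app (Q.s a) x))
    refine (congrArg (fun z => f.app (Q.t a) (X.map a z)) h₁).trans (Eq.trans ?_ h₂.symm)
    exact (LinearMap.congr_fun (f.comm a) x).symm

/-- The first projection of a direct sum. -/
def fst (A B : QRep F Q) : Hom (dsum A B) A where
  app i := LinearMap.fst F (A.M i) (B.M i)
  comm _ := rfl

/-- The first inclusion into a direct sum. -/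
def inl (A B : QRep F Q) : Hom A (dsum A B) where
  app i := LinearMap.inl F (A.M i) (B.M i)
  comm a := by
    apply LinearMap.ext
    intro x
    exact Prod.ext rfl (map_zero (B.map a))

theorem bijective_map_of_iso {X Y : QRep F Q} {f : Hom X Y} (hf : f.IsIso) {a : Q.A}
    (ha : Function.Bijective (X.map a)) : Function.Bijective (Y.map a) := by
  have h : Function.Bijective (Y.map a ∘ f.app (Q.s a)) := by
    have h' : Y.map a ∘ f.app (Q.s a) = f.app (Q.t a) ∘ X.map a :=
      funext fun x => LinearMap.congr_fun (f.comm a) x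
    rw [h']
    exact (hf _).comp ha
  exact (Function.Bijective.of_comp_iff _ (hf _)).1 h

theorem bijective_map_of_dsum {A B : QRep F Q} {a : Q.A}
    (h : Function.Bijective ((dsum A B).map a)) :
    Function.Bijective (A.map a) ∧ Function.Bijective (B.map a) :=
  (Prod.map_bijective (f := A.map a) (g := B.map a)).1 h

/-- If all arrow maps outside a set of arrows are bijective, and the representation vanishes
at one vertex and at both ends of each arrow of the set, then it is zero. -/
theorem not_nonzero_of_vanishing (hQ : Q.Connected) (X : QRep F Q) {T : Set Q.A} {S : Set Q.V}
    (hX : ∀ a ∉ T, Function.Bijective (X.map a)) {i₀ : Q.V} (hi₀ : i₀ ∈ S)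
    (hT : ∀ a ∈ T, Q.s a ∈ S ∧ Q.t a ∈ S) (hS : ∀ i ∈ S, Subsingleton (X.M i)) :
    ¬ X.Nonzero := by
  rintro ⟨j, x, hx⟩
  have key : Subsingleton (X.M j) := by
    have h := hQ i₀ j
    clear hx x
    induction h with
    | refl => exact hS _ hi₀
    | @tail k l _ hkl ih =>
      obtain ⟨a, ⟨rfl, rfl⟩ | ⟨rfl, rfl⟩⟩ := hkl
      · by_cases ha : a ∈ T
        · exact hS _ (hT a ha).2
        · exact (hX a ha).2.subsingleton
      · by_cases ha : a ∈ T
        · exact hS _ (hT a ha).1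
        · exact (hX a ha).1.subsingleton
  exact hx (Subsingleton.elim _ _)

/-- Over a connected quiver, every nonzero FLEI representation has an indecomposable FLEI
direct summand, given here by its projection and inclusion. -/
theorem exists_indec_summand (hQ : Q.Connected) {I : QRep F Q} (hI : I.IsFLEI)
    (hI₀ : I.Nonzero) :
    ∃ (V : QRep F Q) (p : Hom I V) (e : Hom V I), V.IsFLEI ∧ V.Indec ∧
      p.Surjective ∧ e.Injective := by
  obtain ⟨i₀, -⟩ := id hI₀
  let T : Set Q.A := {a | ¬ Function.Bijective (I.map a)}
  have hTfin : T.Finite := hI.2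
  classical
  let S : Finset Q.V := insert i₀ (hTfin.toFinset.image Q.s ∪ hTfin.toFinset.image Q.t)
  have hTS : ∀ a ∈ T, Q.s a ∈ (S : Set Q.V) ∧ Q.t a ∈ (S : Set Q.V) := by
    intro a ha
    have ha' : a ∈ hTfin.toFinset := hTfin.mem_toFinset.2 ha
    constructor <;> apply Finset.mem_insert_of_mem
    · exact Finset.mem_union_left _ (Finset.mem_image_of_mem _ ha')
    · exact Finset.mem_union_right _ (Finset.mem_image_of_mem _ ha')
  let P : QRep F Q → Prop := fun V => V.Nonzero ∧ (∀ a ∉ T, Function.Bijective (V.map a)) ∧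
    ∃ (p : Hom I V) (e : Hom V I), p.Surjective ∧ e.Injective
  let d : QRep F Q → ℕ := fun V => ∑ i ∈ S, Module.finrank F (V.M i)
  have hPI : P I := ⟨hI₀, fun a ha => not_not.1 ha,
    ⟨fun _ => LinearMap.id, fun _ => rfl⟩, ⟨fun _ => LinearMap.id, fun _ => rfl⟩,
    fun _ => Function.surjective_id, fun _ => Function.injective_id⟩
  let V := Function.argminOn d {V | P V} ⟨I, hPI⟩
  have hPV : P V := Function.argminOn_mem d {V | P V} ⟨I, hPI⟩
  have hmin : ∀ X, P X → d V ≤ d X := fun X hX => Function.argminOn_le d {V | P V} hX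
  clear_value V
  obtain ⟨hV₀, hVT, p, e, hp, he⟩ := hPV
  have hfin : ∀ i, FiniteDimensional F (V.M i) := fun i =>
    have := hI.1 i
    Module.Finite.of_surjective (p.app i) (hp i)
  refine ⟨V, p, e, ⟨hfin, hTfin.subset fun a ha haT => ?_⟩, ⟨hV₀, ?_⟩, hp, he⟩
  · exact ha (hVT a (not_not.2 haT))
  rintro A B hA hB ⟨φ, hφ⟩
  have hbij : ∀ a ∉ T, Function.Bijective (A.map a) ∧ Function.Bijective (B.map a) :=
    fun a ha => bijective_map_of_dsum (bijective_map_of_iso hφ (hVT a ha))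
  have hPA : P A := by
    refine ⟨hA, fun a ha => (hbij a ha).1, ((fst A B).comp φ).comp p,
      e.comp ((φ.inv hφ).comp (inl A B)), fun i => ?_, fun i => ?_⟩
    · exact ((Prod.fst_surjective (α := A.M i) (β := B.M i)).comp (hφ i).2).comp (hp i)
    · exact (he i).comp ((LinearEquiv.ofBijective (φ.app i) (hφ i)).symm.injective.comp
        (LinearMap.inl_injective (R := F) (M := A.M i) (M₂ := B.M i)))
  have hequiv : ∀ i, Nonempty (V.M i ≃ₗ[F] A.M i × B.M i) := fun i =>
    ⟨LinearEquiv.ofBijective (φ.app i) (hφ i)⟩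
  have hfinAB : ∀ i, FiniteDimensional F (A.M i) ∧ FiniteDimensional F (B.M i) := fun i => by
    obtain ⟨E⟩ := hequiv i
    have := hfin i
    have := Module.Finite.equiv E
    exact ⟨Module.Finite.of_surjective (LinearMap.fst F (A.M i) (B.M i)) Prod.fst_surjective,
      Module.Finite.of_surjective (LinearMap.snd F (A.M i) (B.M i)) Prod.snd_surjective⟩
  have hd : d V = d A + d B := by
    simp only [d, ← Finset.sum_add_distrib]
    refine Finset.sum_congr rfl fun i _ => ?_
    obtain ⟨E⟩ := hequiv i
    have := (hfinAB i).1
    have := (hfinAB i).2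
    rw [E.finrank_eq, Module.finrank_prod]
  have hdB : d B = 0 := by
    have := hmin A hPA
    omega
  refine not_nonzero_of_vanishing hQ B (S := S) (fun a ha => (hbij a ha).2)
    (Finset.mem_insert_self i₀ _) hTS (fun i hi => ?_) hB
  have := (hfinAB i).2
  exact Module.finrank_zero_iff.1 (Finset.sum_eq_zero_iff.1 hdB i hi)

/-- The image of a morphism, as a subrepresentation of the target. -/
def Hom.range {U W : QRep F Q} (f : Hom U W) : Subrep W where
  S i := LinearMap.range (f.app i)
  stable a := by
    rintro _ ⟨x, rfl⟩
    exact ⟨U.map a x, (LinearMap.congr_fun (f.comm a) x).symm⟩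

/-- A morphism, corestricted to its image. -/
def Hom.rangeRestrict {U W : QRep F Q} (f : Hom U W) : Hom U f.range.toRep where
  app i := (f.app i).rangeRestrict
  comm a := LinearMap.ext fun x => Subtype.ext (LinearMap.congr_fun (f.comm a) x)

theorem Hom.rangeRestrict_surjective {U W : QRep F Q} (f : Hom U W) :
    f.rangeRestrict.Surjective :=
  fun i => (f.app i).surjective_rangeRestrict

theorem isFLEI_range {U W : QRep F Q} (hU : U.IsFLEI) (hW : W.IsFLEI) (f : Hom U W) :
    f.range.toRep.IsFLEI := by
  refine ⟨fun i => ?_, (hU.2.union hW.2).subset fun a ha => ?_⟩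
  · have := hU.1 i
    exact Module.Finite.of_surjective _ (f.rangeRestrict_surjective i)
  · by_contra h
    rw [Set.mem_union, not_or] at h
    have hUa : Function.Bijective (U.map a) := not_not.1 h.1
    have hWa : Function.Bijective (W.map a) := not_not.1 h.2
    refine ha ⟨fun x y hxy => Subtype.ext (hWa.1 (congrArg Subtype.val hxy)), fun y => ?_⟩
    obtain ⟨z, rfl⟩ := f.rangeRestrict_surjective _ y
    obtain ⟨x, rfl⟩ := hUa.2 z
    exact ⟨f.rangeRestrict.app _ x, LinearMap.congr_fun (f.rangeRestrict.comm a) x⟩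

/-- The inclusion of a subrepresentation. -/
def subtype {W : QRep F Q} (X : Subrep W) : Hom X.toRep W where
  app i := (X.S i).subtype
  comm _ := rfl

end QRep

/-- On a connected, eventually outward, finitely branching tree quiver,
a morphism of indecomposable FLEI representations which is nonzero, not an isomorphism,
not surjective and not injective factors as a nontrivial surjection onto an
indecomposable FLEI representation followed by a nontrivial injection. -/
theorem stmt4 (F : Type) [Field F] (Q : Quiv)
    (htree : Q.IsTree) (hout : Q.EventuallyOutward) (hfb : Q.FinitelyBranching)
    (U W : QRep F Q) (hU : U.IsFLEI ∧ U.Indec) (hW : W.IsFLEI ∧ W.Indec)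
    (f : QRep.Hom U W) (hnz : f.Nonzero) (hni : ¬ f.IsIso)
    (hnsurj : ¬ f.Surjective) (hninj : ¬ f.Injective) :
    ∃ (V : QRep F Q) (g : QRep.Hom U V) (h : QRep.Hom V W),
      V.IsFLEI ∧ V.Indec ∧
      g.Surjective ∧ g.Nonzero ∧ ¬ g.IsIso ∧
      h.Injective ∧ h.Nonzero ∧ ¬ h.IsIso := by
  obtain ⟨i₀, hi₀⟩ := hnz
  have hI₀ : f.range.toRep.Nonzero := by
    obtain ⟨x, hx⟩ : ∃ x, f.app i₀ x ≠ 0 := by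
      by_contra! h
      exact hi₀ (LinearMap.ext h)
    exact ⟨i₀, ⟨f.app i₀ x, x, rfl⟩, fun h => hx (congrArg Subtype.val h)⟩
  obtain ⟨V, p, e, hV, hVi, hp, he⟩ :=
    QRep.exists_indec_summand htree.1 (QRep.isFLEI_range hU.1 hW.1 f) hI₀
  have hg : (p.comp f.rangeRestrict).Surjective := fun i =>
    (hp i).comp (f.rangeRestrict_surjective i)
  have hh : ((QRep.subtype f.range).comp e).Injective := fun i =>
    Subtype.val_injective.comp (he i)
  obtain ⟨j, v, hv⟩ := hVi.1
  refine ⟨V, p.comp f.rangeRestrict, (QRep.subtype f.range).comp e, hV, hVi, hg, ⟨j, fun h => ?_⟩,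
    fun h => hninj fun i => ?_, hh, ⟨j, fun h => ?_⟩, fun h => hnsurj fun i w => ?_⟩
  · obtain ⟨u, rfl⟩ := hg j v
    exact hv (LinearMap.congr_fun h u)
  · intro x y hxy
    exact (h i).1 (congrArg (p.app i) (Subtype.ext hxy))
  · exact hv (hh j ((LinearMap.congr_fun h v).trans (map_zero _).symm))
  · obtain ⟨v, rfl⟩ := (h i).2 w
    exact (e.app i v).2
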